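/- arXiv:2601.05771 — 2 statements merged into one kernel-verified Lean document; each statement's English description precedes it below -/
import Mathlib

section
/- Let T = (V, E) be a tree and let wz ∈ E. Suppose the component T_w of T − wz (the subtree containing w) contains a centre edge of T. Then |V_w| > |V_z|. -/
open Finset

/-- The number of vertices of the component of `G - uv` containing `u`, i.e. `|V_u|`. -/
noncomputable def sideCard {V : Type*} [Fintype V] (G : SimpleGraph V) (u v : V) : ℕ :=
  Nat.card {w : V | (G.deleteEdges {s(u, v)}).Reachable u w}
/-- `uv` is a centre edge of `T`: it is an edge minimizing `| |V_u| - |V_v| |`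
over all edges of `T`. -/
def IsCentreEdge {V : Type*} [Fintype V] (T : SimpleGraph V) (u v : V) : Prop :=
  T.Adj u v ∧ ∀ a b, T.Adj a b →
    |(sideCard T u v : ℤ) - (sideCard T v u : ℤ)| ≤
      |(sideCard T a b : ℤ) - (sideCard T b a : ℤ)|

open SimpleGraph in
theorem SimpleGraph.Preconnected.reachable_deleteEdges_or {V : Type*} {G : SimpleGraph V}
    (hG : G.Preconnected) (u v x : V) :
    (G.deleteEdges {s(u, v)}).Reachable u x ∨ (G.deleteEdges {s(u, v)}).Reachable v x := by
  have h := (reachable_iff_reflTransGen u x).1 (hG u x)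
  induction h with
  | refl => exact Or.inl (Reachable.refl u)
  | @tail y x _ hyx ih =>
    by_cases he : s(y, x) = s(u, v)
    · rcases Sym2.eq_iff.1 he with ⟨-, rfl⟩ | ⟨-, rfl⟩
      · exact Or.inr (Reachable.refl _)
      · exact Or.inl (Reachable.refl _)
    · have hadj : (G.deleteEdges {s(u, v)}).Adj y x := by
        simpa [deleteEdges_adj] using And.intro hyx he
      exact ih.imp (fun h => h.trans hadj.reachable) (fun h => h.trans hadj.reachable)

theorem SimpleGraph.IsAcyclic.not_reachable_deleteEdges {V : Type*} {G : SimpleGraph V}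
    (hG : G.IsAcyclic) {u v : V} (huv : G.Adj u v) :
    ¬ (G.deleteEdges {s(u, v)}).Reachable u v :=
  SimpleGraph.isBridge_iff.1 (SimpleGraph.isAcyclic_iff_forall_adj_isBridge.1 hG huv)

theorem sideCard_add_sideCard {V : Type*} [Fintype V] {T : SimpleGraph V} (hT : T.IsTree)
    {u v : V} (huv : T.Adj u v) : sideCard T u v + sideCard T v u = Fintype.card V := by
  have hcompl : {x | (T.deleteEdges {s(v, u)}).Reachable v x} =
      {x | (T.deleteEdges {s(u, v)}).Reachable u x}ᶜ := by
    ext x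
    rw [Sym2.eq_swap]
    constructor
    · intro hv hu
      exact hT.isAcyclic.not_reachable_deleteEdges huv (hu.trans hv.symm)
    · exact (hT.connected.preconnected.reachable_deleteEdges_or u v x).resolve_left
  unfold sideCard
  rw [hcompl, Nat.card_coe_set_eq, Nat.card_coe_set_eq, Set.ncard_add_ncard_compl,
    Nat.card_eq_fintype_card]

open SimpleGraph in
/-- If both ends of an edge `ab` lie on the `w`-side of the edge `wz`, then the side of `ab`
containing `w` is larger than the `z`-side of `wz`. -/
theorem sideCard_lt_sideCard {V : Type*} [Fintype V] {T : SimpleGraph V} (hT : T.IsAcyclic)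
    {w z a b : V} (hwz : T.Adj w z)
    (ha : (T.deleteEdges {s(w, z)}).Reachable w a)
    (hb : (T.deleteEdges {s(w, z)}).Reachable w b)
    (haw : (T.deleteEdges {s(a, b)}).Reachable a w) :
    sideCard T z w < sideCard T a b := by
  have hdisj : ∀ x, (T.deleteEdges {s(w, z)}).Reachable z x →
      ¬ (T.deleteEdges {s(w, z)}).Reachable w x := fun x hz hw =>
    hT.not_reachable_deleteEdges hwz (hw.trans hz.symm)
  have hadj : ∀ {x y}, T.Adj x y → ¬ (T.deleteEdges {s(w, z)}).Reachable w y →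
      (T.deleteEdges {s(a, b)}).Adj x y := by
    intro x y hxy hy
    rw [deleteEdges_adj]
    refine ⟨hxy, fun he => ?_⟩
    rcases Sym2.eq_iff.1 (Set.mem_singleton_iff.1 he) with ⟨-, rfl⟩ | ⟨-, rfl⟩
    · exact hy hb
    · exact hy ha
  have haz : (T.deleteEdges {s(a, b)}).Reachable a z :=
    haw.trans (hadj hwz (hdisj z (Reachable.refl z))).reachable
  unfold sideCard
  rw [Nat.card_coe_set_eq, Nat.card_coe_set_eq, Sym2.eq_swap (a := z)]
  refine Set.ncard_lt_ncard ((Set.ssubset_iff_of_subset fun x hx => ?_).2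
    ⟨w, haw, fun hw => hdisj w hw (Reachable.refl w)⟩)
  have h := (reachable_iff_reflTransGen z x).1 hx
  clear hx
  induction h with
  | refl => exact haz
  | @tail y x hzy hyx ih =>
    have hx := ((reachable_iff_reflTransGen z y).2 hzy).trans hyx.reachable
    exact Reachable.trans ih (hadj (deleteEdges_le _ hyx) (hdisj x hx)).reachable


/-- Let `T` be a tree, `wz` an edge of `T`, and suppose the component
`T_w` of `T - wz` containing `w` contains a centre edge `ab` of `T` (both endpoints
`a, b` are reachable from `w` in `T - wz`).  Then `|V_w| > |V_z|`. -/
theorem stmt6 {V : Type*} [Fintype V] (T : SimpleGraph V) (hT : T.IsTree)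
    (w z : V) (hwz : T.Adj w z) (a b : V) (hab : IsCentreEdge T a b)
    (ha : (T.deleteEdges {s(w, z)}).Reachable w a)
    (hb : (T.deleteEdges {s(w, z)}).Reachable w b) :
    sideCard T z w < sideCard T w z := by
  have hwz_sum := sideCard_add_sideCard hT hwz
  have hab_sum := sideCard_add_sideCard hT hab.1
  have hmin := hab.2 w z hwz
  by_contra! hle
  rw [abs_of_nonpos (by omega : (sideCard T w z : ℤ) - sideCard T z w ≤ 0), abs_le] at hmin
  rcases hT.connected.preconnected.reachable_deleteEdges_or a b w with haw | hbw
  · have := sideCard_lt_sideCard hT.isAcyclic hwz ha hb haw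
    omega
  · have := sideCard_lt_sideCard hT.isAcyclic hwz hb ha (by rwa [Sym2.eq_swap])
    omega
end

section
/- Let T be a tree on n vertices with maximum vertex degree d_max. (1) If n is even, then b(T) ≥ 2/n when d_max ≤ n/2, and b(T) ≥ n/(2·d_max·(n − d_max)) when d_max > n/2. (2) If n is odd, then b(T) ≥ 2n/(n² − 1) when d_max ≤ ⌊n/2⌋ + 1, and b(T) ≥ n/(2·d_max·(n − d_max)) when d_max > ⌊n/2⌋ + 1. -/
open Finset

open Classical in
/-- The ℓ1-Fiedler value `b(G)`: the minimum of `∑_{uv ∈ E(G)} |x_u - x_v|` over all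
`x : V → ℝ` with `∑_v x_v = 0` and `∑_v |x_v| = 1`.  (Each edge `uv` contributes
`|x_u - x_v|` once; the double sum over ordered pairs counts it twice, whence the `1/2`.) -/
noncomputable def l1Fiedler {V : Type*} [Fintype V] (G : SimpleGraph V) : ℝ :=
  sInf { y : ℝ | ∃ x : V → ℝ, (∑ v, x v) = 0 ∧ (∑ v, |x v|) = 1 ∧
    y = (1 / 2) * ∑ u, ∑ v, if G.Adj u v then |x u - x v| else 0 }

open MeasureTheory in
/-- A coarea-type inequality: weights with nonnegative total over every directed cut have
nonnegative total against the positive parts of the differences of any function. -/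
theorem sum_mul_max_sub_nonneg {V : Type*} [Fintype V] [DecidableEq V] (w : V → V → ℝ)
    (hw : ∀ S : Finset V, 0 ≤ ∑ u ∈ S, ∑ v ∈ Sᶜ, w u v) (x : V → ℝ) :
    0 ≤ ∑ u, ∑ v, w u v * max (x u - x v) 0 := by
  have hint : ∀ u v, Integrable
      (fun t => w u v * (Set.Ico (x v) (x u)).indicator (fun _ => (1 : ℝ)) t) := fun u v =>
    ((integrable_indicator_iff measurableSet_Ico).2 (integrableOn_const (by simp))).const_mul _
  have key : ∑ u, ∑ v, w u v * max (x u - x v) 0 =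
      ∫ t, ∑ u, ∑ v, w u v * (Set.Ico (x v) (x u)).indicator (fun _ => (1 : ℝ)) t := by
    rw [integral_finsetSum _ fun u _ => integrable_finsetSum _ fun v _ => hint u v]
    refine sum_congr rfl fun u _ => ?_
    rw [integral_finsetSum _ fun v _ => hint u v]
    refine sum_congr rfl fun v _ => ?_
    rw [integral_const_mul, integral_indicator measurableSet_Ico]
    simp
  rw [key]
  refine integral_nonneg fun t => (hw {u | t < x u}).trans_eq ?_
  rw [sum_filter]
  refine sum_congr rfl fun u _ => ?_
  split_ifs with hu
  · rw [compl_filter, sum_filter]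
    refine sum_congr rfl fun v _ => ?_
    simp [Set.indicator_apply, hu]
  · simp [hu]

theorem sum_mul_abs_sub_nonneg {V : Type*} [Fintype V] [DecidableEq V] (w : V → V → ℝ)
    (hw : ∀ S : Finset V, 0 ≤ ∑ u ∈ S, ∑ v ∈ Sᶜ, w u v) (x : V → ℝ) :
    0 ≤ ∑ u, ∑ v, w u v * |x u - x v| := by
  refine (add_nonneg (sum_mul_max_sub_nonneg w hw x)
    (sum_mul_max_sub_nonneg w hw (-x))).trans_eq ?_
  simp only [← sum_add_distrib, ← mul_add]
  refine sum_congr rfl fun u _ => sum_congr rfl fun v _ => ?_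
  congr 1
  rcases le_total (x u) (x v) with h | h
  · rw [abs_of_nonpos (by linarith), max_eq_right (by linarith), max_eq_left (by simpa using h)]
    simp [neg_add_eq_sub]
  · rw [abs_of_nonneg (by linarith), max_eq_left (by linarith), max_eq_right (by simpa using h)]
    simp

theorem card_mul_sum_abs_le_sum_abs_sub {V : Type*} [Fintype V] (x : V → ℝ)
    (hx : ∑ v, x v = 0) :
    (Fintype.card V : ℝ) * ∑ v, |x v| ≤ ∑ u, ∑ v, |x u - x v| := by
  rw [mul_sum]
  refine sum_le_sum fun u _ => ?_
  refine le_trans (le_of_eq ?_) (abs_sum_le_sum_abs _ _)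
  rw [sum_sub_distrib, hx]
  simp [abs_mul]

theorem exists_sum_eq_zero_sum_abs_eq_one (V : Type*) [Fintype V] [Nontrivial V] :
    ∃ x : V → ℝ, ∑ v, x v = 0 ∧ ∑ v, |x v| = 1 := by
  classical
  obtain ⟨a, b, hab⟩ := exists_pair_ne V
  refine ⟨fun v => (if v = a then 1 / 2 else 0) - (if v = b then 1 / 2 else 0), by simp, ?_⟩
  have h : ∀ v, |(if v = a then (1 / 2 : ℝ) else 0) - (if v = b then 1 / 2 else 0)| =
      (if v = a then 1 / 2 else 0) + (if v = b then 1 / 2 else 0) := by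
    intro v
    by_cases ha : v = a
    · simp [ha, hab]
    · by_cases hb : v = b <;> simp [ha, hb, hab.symm]
  simp only [h, sum_add_distrib]
  norm_num

/-- An isoperimetric inequality for edge cuts bounds the ℓ1-Fiedler value from below. -/
theorem le_l1Fiedler_of_le_card_interedges {V : Type*} [Fintype V] [DecidableEq V]
    [Nontrivial V] (G : SimpleGraph V) [DecidableRel G.Adj] {c : ℝ} (hc : 0 ≤ c)
    (h : ∀ S : Finset V, S.Nonempty → Sᶜ.Nonempty →
      c * (#S * #Sᶜ) ≤ #(G.interedges S Sᶜ)) :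
    c * Fintype.card V / 2 ≤ l1Fiedler G := by
  have hcut : ∀ S : Finset V,
      0 ≤ ∑ u ∈ S, ∑ v ∈ Sᶜ, ((if G.Adj u v then (1 : ℝ) else 0) - c) := by
    intro S
    rcases S.eq_empty_or_nonempty with rfl | hS
    · simp
    rcases Sᶜ.eq_empty_or_nonempty with hS' | hS'
    · simp [hS']
    have hcard : ∑ u ∈ S, ∑ v ∈ Sᶜ, (if G.Adj u v then (1 : ℝ) else 0) =
        #(G.interedges S Sᶜ) := by
      rw [SimpleGraph.interedges_def, card_filter, sum_product]
      push_cast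
      rfl
    simp only [sum_sub_distrib, hcard, sum_const, nsmul_eq_mul]
    linarith [h S hS hS']
  obtain ⟨x₀, h₀, h₁⟩ := exists_sum_eq_zero_sum_abs_eq_one V
  refine le_csInf ⟨_, x₀, h₀, h₁, rfl⟩ ?_
  rintro _ ⟨x, hx, hx', rfl⟩
  have hpos := sum_mul_abs_sub_nonneg _ hcut x
  simp only [sub_mul, ite_mul, one_mul, zero_mul, sum_sub_distrib, ← mul_sum] at hpos
  have hle := mul_le_mul_of_nonneg_left (card_mul_sum_abs_le_sum_abs_sub x hx) hc
  rw [hx', mul_one] at hle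
  have hE : (∑ u, ∑ v, @ite ℝ (G.Adj u v) (Classical.propDecidable _) |x u - x v| 0) =
      ∑ u, ∑ v, if G.Adj u v then |x u - x v| else 0 := by
    refine sum_congr rfl fun u _ => sum_congr rfl fun v _ => ?_
    congr
  rw [hE]
  linarith

theorem SimpleGraph.Connected.card_interedges_compl_pos {V : Type*} [Fintype V]
    [DecidableEq V] {G : SimpleGraph V} [DecidableRel G.Adj] (hG : G.Connected)
    {S : Finset V} (hS : S.Nonempty) (hS' : Sᶜ.Nonempty) : 0 < #(G.interedges S Sᶜ) := by
  obtain ⟨a, ha⟩ := hS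
  obtain ⟨b, hb⟩ := hS'
  obtain ⟨p⟩ := hG.preconnected a b
  obtain ⟨d, -, h₁, h₂⟩ := p.exists_boundary_dart (S : Set V) ha (by simpa using hb)
  exact card_pos.2 ⟨(d.fst, d.snd), (SimpleGraph.mem_interedges_iff G).2
    ⟨by simpa using h₁, by simpa using h₂, d.adj⟩⟩

theorem SimpleGraph.degree_add_card_lt {V : Type*} [Fintype V] [DecidableEq V]
    (G : SimpleGraph V) [DecidableRel G.Adj] {S : Finset V} {v : V} (hv : v ∉ S) :
    G.degree v + #S < Fintype.card V + #(G.interedges S Sᶜ) := by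
  have h₁ : #(G.neighborFinset v ∩ S) ≤ #(G.interedges S Sᶜ) := by
    refine card_le_card_of_injOn (fun u => (u, v)) ?_ fun _ _ _ _ h => congrArg Prod.fst h
    intro u hu
    simp only [coe_inter, Set.mem_inter_iff, mem_coe, SimpleGraph.mem_neighborFinset] at hu
    exact (SimpleGraph.mem_interedges_iff G).2 ⟨hu.2, by simpa using hv, hu.1.symm⟩
  have h₂ : #(G.neighborFinset v ∪ S) < Fintype.card V :=
    card_lt_univ_of_notMem (x := v) (by simp [hv])
  have h₃ := card_union_add_card_inter (G.neighborFinset v) S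
  rw [SimpleGraph.card_neighborFinset_eq_degree] at h₃
  omega

theorem SimpleGraph.Connected.card_mul_card_compl_le {V : Type*} [Fintype V] [DecidableEq V]
    {G : SimpleGraph V} [DecidableRel G.Adj] (hG : G.Connected) {v : V}
    (hv : Fintype.card V < 2 * G.degree v) {S : Finset V} (hS : S.Nonempty)
    (hS' : Sᶜ.Nonempty) :
    (#S * #Sᶜ : ℝ) ≤
      #(G.interedges S Sᶜ) * (G.degree v * (Fintype.card V - G.degree v)) := by
  wlog hvS : v ∉ S generalizing S
  · have := this hS' (by simpa using hS) (by simpa using hvS)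
    rw [compl_compl] at this
    rw [mul_comm (#S : ℝ)]
    convert this using 3
    have := G.symm
    exact Rel.card_interedges_comm _ _
  have hk := hG.card_interedges_compl_pos hS hS'
  have hlt := G.degree_add_card_lt hvS
  have hd : G.degree v < Fintype.card V := G.degree_lt_card_verts v
  have hsum : #S + #Sᶜ = Fintype.card V := card_add_card_compl S
  generalize #(G.interedges S Sᶜ) = k at *
  generalize G.degree v = d at *
  generalize #S = s at *
  generalize #Sᶜ = t at *
  generalize Fintype.card V = n at *
  obtain ⟨m, rfl⟩ := Nat.exists_eq_add_of_lt hd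
  have hnat : s * t ≤ k * (d * (m + 1)) := by
    rcases le_total s (m + 1) with h | h
    · obtain ⟨r, hr⟩ := Nat.exists_eq_add_of_le h
      obtain rfl : t = d + r := by omega
      have : s * (d + r) ≤ d * (m + 1) := by
        rw [hr]
        have : s ≤ d := by omega
        nlinarith [Nat.mul_le_mul_right r this]
      exact this.trans (Nat.le_mul_of_pos_left _ hk)
    · have ht : t ≤ d := by omega
      have hs : s ≤ k * (m + 1) := by
        obtain ⟨j, rfl⟩ := Nat.exists_eq_add_of_lt hk
        have : s ≤ m + 1 + j := by omega
        nlinarith [Nat.zero_le (j * m)]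
      calc s * t ≤ (k * (m + 1)) * d := Nat.mul_le_mul hs ht
        _ = _ := by ring
  have hm : ((d + m + 1 : ℕ) : ℝ) - d = (m + 1 : ℕ) := by
    push_cast
    ring
  rw [hm]
  exact_mod_cast hnat

theorem SimpleGraph.Connected.le_l1Fiedler_of_card_lt_two_mul_maxDegree {V : Type*}
    [Fintype V] {G : SimpleGraph V} [DecidableRel G.Adj] (hG : G.Connected)
    (hd : Fintype.card V < 2 * G.maxDegree) :
    (Fintype.card V : ℝ) /
      (2 * (G.maxDegree : ℝ) * ((Fintype.card V : ℝ) - (G.maxDegree : ℝ))) ≤ l1Fiedler G := by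
  classical
  have := hG.nonempty
  obtain ⟨v, hv⟩ := G.exists_maximal_degree_vertex
  rw [hv] at hd ⊢
  have hlt : G.degree v < Fintype.card V := G.degree_lt_card_verts v
  have : Nontrivial V := Fintype.one_lt_card_iff_nontrivial.1 (by omega)
  have hpos : (0 : ℝ) < G.degree v * (Fintype.card V - G.degree v) :=
    mul_pos (Nat.cast_pos.2 (by omega)) (sub_pos.2 (Nat.cast_lt.2 hlt))
  refine le_trans (le_of_eq ?_) (le_l1Fiedler_of_le_card_interedges G
    (c := 1 / (G.degree v * (Fintype.card V - G.degree v))) (by positivity)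
    fun S hS hS' => ?_)
  · rw [one_div_mul_eq_div, div_div]
    ring_nf
  · rw [one_div_mul_eq_div, div_le_iff₀ hpos]
    exact hG.card_mul_card_compl_le hd hS hS'

theorem SimpleGraph.Connected.le_l1Fiedler_of_four_mul_card_le {V : Type*} [Fintype V]
    [DecidableEq V] [Nontrivial V] {G : SimpleGraph V} (hG : G.Connected) {M : ℝ} (hM : 0 < M)
    (h : ∀ S : Finset V, 4 * (#S * #Sᶜ : ℝ) ≤ M) :
    2 * Fintype.card V / M ≤ l1Fiedler G := by
  classical
  refine le_trans (le_of_eq ?_) (le_l1Fiedler_of_le_card_interedges G (c := 4 / M)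
    (by positivity) fun S hS hS' => ?_)
  · ring
  · have hk : (1 : ℝ) ≤ #(G.interedges S Sᶜ) :=
      Nat.one_le_cast.2 (hG.card_interedges_compl_pos hS hS')
    refine le_trans ?_ hk
    rw [div_mul_eq_mul_div, div_le_one hM]
    exact h S

theorem l1Fiedler_nonneg {V : Type*} [Fintype V] (G : SimpleGraph V) : 0 ≤ l1Fiedler G := by
  refine Real.sInf_nonneg ?_
  rintro _ ⟨x, -, -, rfl⟩
  refine mul_nonneg (by norm_num) (sum_nonneg fun u _ => sum_nonneg fun v _ => ?_)
  split_ifs <;> positivity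

theorem SimpleGraph.Connected.two_div_card_le_l1Fiedler {V : Type*} [Fintype V] [Nontrivial V]
    {G : SimpleGraph V} (hG : G.Connected) : 2 / (Fintype.card V : ℝ) ≤ l1Fiedler G := by
  classical
  have hn : (0 : ℝ) < Fintype.card V := Nat.cast_pos.2 Fintype.card_pos
  refine le_trans (le_of_eq ?_) (hG.le_l1Fiedler_of_four_mul_card_le
    (M := (Fintype.card V : ℝ) ^ 2) (by positivity) fun S => ?_)
  · field_simp
  · rw [← card_add_card_compl S]
    push_cast
    nlinarith [sq_nonneg ((#S : ℝ) - #Sᶜ)]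

theorem SimpleGraph.Connected.le_l1Fiedler_of_odd {V : Type*} [Fintype V]
    {G : SimpleGraph V} (hG : G.Connected) (hodd : Odd (Fintype.card V)) :
    2 * (Fintype.card V : ℝ) / ((Fintype.card V : ℝ) ^ 2 - 1) ≤ l1Fiedler G := by
  classical
  rcases subsingleton_or_nontrivial V with hV | hV
  · have : Fintype.card V = 1 :=
      le_antisymm (Fintype.card_le_one_iff_subsingleton.2 hV) hodd.pos
    simpa [this] using l1Fiedler_nonneg G
  have hn : (1 : ℝ) < Fintype.card V := Nat.one_lt_cast.2 Fintype.one_lt_card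
  refine hG.le_l1Fiedler_of_four_mul_card_le (by nlinarith) fun S => ?_
  rw [← card_add_card_compl S] at hodd ⊢
  have hne : ((#S : ℤ) - #Sᶜ) ≠ 0 := by
    intro h0
    have : #S = #Sᶜ := by omega
    rw [← this] at hodd
    exact Nat.not_even_iff_odd.2 hodd ⟨_, rfl⟩
  have hsq : (1 : ℤ) ≤ ((#S : ℤ) - #Sᶜ) ^ 2 := Int.add_one_le_of_lt (sq_pos_of_ne_zero hne)
  have hsq' : (1 : ℝ) ≤ ((#S : ℝ) - #Sᶜ) ^ 2 := by exact_mod_cast hsq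
  push_cast
  nlinarith

/-- Let `T` be a tree on `n` vertices with maximum degree `d_max`.
(1) If `n` is even, then `b(T) ≥ 2/n` when `d_max ≤ n/2`, and
`b(T) ≥ n/(2 d_max (n - d_max))` when `d_max > n/2`.
(2) If `n` is odd, then `b(T) ≥ 2n/(n² - 1)` when `d_max ≤ ⌊n/2⌋ + 1`, and
`b(T) ≥ n/(2 d_max (n - d_max))` when `d_max > ⌊n/2⌋ + 1`. -/
theorem stmt11 {V : Type*} [Fintype V] (T : SimpleGraph V) [DecidableRel T.Adj]
    (hT : T.IsTree) :
    (Even (Fintype.card V) →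
      (2 * T.maxDegree ≤ Fintype.card V → l1Fiedler T ≥ 2 / (Fintype.card V : ℝ)) ∧
      (Fintype.card V < 2 * T.maxDegree →
        l1Fiedler T ≥ (Fintype.card V : ℝ) /
          (2 * (T.maxDegree : ℝ) * ((Fintype.card V : ℝ) - (T.maxDegree : ℝ))))) ∧
    (Odd (Fintype.card V) →
      (T.maxDegree ≤ Fintype.card V / 2 + 1 →
        l1Fiedler T ≥ 2 * (Fintype.card V : ℝ) / ((Fintype.card V : ℝ) ^ 2 - 1)) ∧
      (Fintype.card V / 2 + 1 < T.maxDegree →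
        l1Fiedler T ≥ (Fintype.card V : ℝ) /
          (2 * (T.maxDegree : ℝ) * ((Fintype.card V : ℝ) - (T.maxDegree : ℝ))))) := by
  have := hT.connected.nonempty
  refine ⟨fun heven => ⟨fun _ => ?_, fun hd =>
    hT.connected.le_l1Fiedler_of_card_lt_two_mul_maxDegree hd⟩, fun hodd =>
    ⟨fun _ => hT.connected.le_l1Fiedler_of_odd hodd, fun hd =>
      hT.connected.le_l1Fiedler_of_card_lt_two_mul_maxDegree (by omega)⟩⟩
  have hpos : 0 < Fintype.card V := Fintype.card_pos
  have : Nontrivial V := Fintype.one_lt_card_iff_nontrivial.1 (by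
    obtain ⟨k, hk⟩ := heven
    omega)
  exact hT.connected.two_div_card_le_l1Fiedler
end
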